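/- arXiv:2403.12681 — 2 statements merged into one kernel-verified Lean document; each statement's English description precedes it below -/
import Mathlib

section
/- Let f ∈ R_9 satisfy conditions (C1)–(C4), let n ≥ 2 be an integer with n ∉ 3ℤ, and let A = R[W]/(Wⁿ − f) = R[w]. Let 𝔊 be the ℕ-grading of A with x ∈ A_{3n}, y ∈ A_{2n}, z ∈ A_n and w ∈ A_9, and let T = T(𝔊) ⊆ Aut_k(A). Then the centralizer of T in Aut_k(A) equals T: C(T) = T. -/
open MvPolynomial

set_option synthInstance.maxHeartbeats 400000
set_option maxHeartbeats 1000000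

noncomputable section

/-- The grading weights `(3, 2, 1)` for the variables `x = X 0`, `y = X 1`, `z = X 2`
of `R = k[x,y,z]`. -/
def w3 : Fin 3 → ℕ := ![3, 2, 1]

/-- `S` is a regular local ring: a Noetherian local ring whose maximal ideal (equivalently,
its Jacobson radical) can be generated by Krull-dimension many elements. -/
def IsRegLocalRing (S : Type*) [CommRing S] : Prop :=
  IsNoetherianRing S ∧ IsLocalRing S ∧
    ∃ s : Finset S, Ideal.span (s : Set S) = (⊥ : Ideal S).jacobson ∧
      (s.card : WithBot (WithTop ℕ)) = ringKrullDim S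

/-- The scheme `Proj ℬ` has at least two singular points, i.e. two distinct points whose
local rings (the stalks of the structure sheaf) are not regular local rings. -/
def ProjHasTwoSingularPoints (k : Type) [Field k] {A : Type} [CommRing A] [Algebra k A]
    (ℬ : ℕ → Submodule k A) [GradedAlgebra ℬ] : Prop :=
  ∃ x y : AlgebraicGeometry.Proj ℬ, x ≠ y ∧
    ¬ IsRegLocalRing ((AlgebraicGeometry.Proj ℬ).presheaf.stalk x) ∧
    ¬ IsRegLocalRing ((AlgebraicGeometry.Proj ℬ).presheaf.stalk y)

/-- Condition (C2): the projective curve `Proj (R/fR)` has at least two singular points.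
Here the grading on `R/fR` is the (unique) `ℕ`-grading `ℬ` induced by the weighted grading of
`R = k[x,y,z]` with weights `(3,2,1)` via the quotient map. -/
def CondC2 (k : Type) [Field k] (f : MvPolynomial (Fin 3) k) : Prop :=
  ∃ (ℬ : ℕ → Submodule k (MvPolynomial (Fin 3) k ⧸ Ideal.span {f}))
    (inst : GradedAlgebra ℬ),
    (∀ (i : ℕ) (r : MvPolynomial (Fin 3) k), r.IsWeightedHomogeneous w3 i →
      Ideal.Quotient.mk (Ideal.span {f}) r ∈ ℬ i) ∧
    @ProjHasTwoSingularPoints k _ _ _ _ ℬ inst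

/-- Conditions (C3) and (C4): `f(x,y,0) = x (p x² + q y³)` with `p, q ∈ k*`, and
`f_z(x,y,0) = y (r x² + s y³)` with `r, s ∈ k` such that `det (3p r; q s) = 3ps - qr ≠ 0`. -/
def CondC3C4 (k : Type) [Field k] (f : MvPolynomial (Fin 3) k) : Prop :=
  ∃ p q r s : k, p ≠ 0 ∧ q ≠ 0 ∧
    aeval ![X 0, X 1, 0] f = X 0 * (C p * X 0 ^ 2 + C q * X 1 ^ 3) ∧
    aeval ![X 0, X 1, 0] (pderiv 2 f) = X 1 * (C r * X 0 ^ 2 + C s * X 1 ^ 3) ∧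
    3 * p * s - q * r ≠ 0

/-- The ideal `(Wⁿ - f)` of `R[W] = k[x,y,z,W]`, where the polynomial ring `R[W]` in one
variable `W = X 3` over `R = k[x,y,z]` is modelled as `MvPolynomial (Fin 4) k`. -/
abbrev relIdealMinus (k : Type) [Field k] (f : MvPolynomial (Fin 3) k) (n : ℕ) :
    Ideal (MvPolynomial (Fin 4) k) :=
  Ideal.span {(X 3 : MvPolynomial (Fin 4) k) ^ n - rename Fin.castSucc f}

/-- The ring `A = R[W]/(Wⁿ - f) = R[w]`. -/
abbrev QuotRingMinus (k : Type) [Field k] (f : MvPolynomial (Fin 3) k) (n : ℕ) : Type :=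
  MvPolynomial (Fin 4) k ⧸ relIdealMinus k f n

/-- The images of the generators `x, y, z, w` in `A = R[W]/(Wⁿ - f)`. -/
def genMinus (k : Type) [Field k] (f : MvPolynomial (Fin 3) k) (n : ℕ) (i : Fin 4) :
    QuotRingMinus k f n :=
  Ideal.Quotient.mk (relIdealMinus k f n) (X i)

/-- `α` belongs to the subtorus `T = T(𝔊)` of `Aut_k(A)` determined by the `ℕ`-grading `𝔊` of
`A = R[W]/(Wⁿ - f)` in which `x ∈ A_{3n}`, `y ∈ A_{2n}`, `z ∈ A_n`, `w ∈ A_9`. -/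
def InTorusMinus (k : Type) [Field k] (f : MvPolynomial (Fin 3) k) (n : ℕ)
    (α : QuotRingMinus k f n ≃ₐ[k] QuotRingMinus k f n) : Prop :=
  ∃ t : kˣ,
    α (genMinus k f n 0) = (t : k) ^ (3 * n) • genMinus k f n 0 ∧
    α (genMinus k f n 1) = (t : k) ^ (2 * n) • genMinus k f n 1 ∧
    α (genMinus k f n 2) = (t : k) ^ n • genMinus k f n 2 ∧
    α (genMinus k f n 3) = (t : k) ^ 9 • genMinus k f n 3


lemma aux_hom {σ k B : Type*} [Field k] [CommRing B] [Algebra k B] (w : σ → ℕ) (d : ℕ)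
    (P : MvPolynomial σ k) (hP : P.IsWeightedHomogeneous w d) (t : k) (g : σ → B) :
    aeval (fun i => t ^ (w i) • g i) P = t ^ d • aeval g P := by
  rw [aeval_def, aeval_def, eval₂_eq, eval₂_eq, Finset.smul_sum]
  refine Finset.sum_congr rfl fun s hs => ?_
  have h := hP (mem_support_iff.mp hs)
  rw [Finsupp.weight_apply, Finsupp.sum] at h
  simp only [Algebra.smul_def, mul_pow, Finset.prod_mul_distrib]
  rw [← h]
  simp only [← map_pow, ← map_prod, ← pow_mul]
  rw [Finset.prod_pow_eq_pow_sum]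
  simp only [smul_eq_mul, mul_comm (w _)]
  ring

lemma aux_poly {k : Type*} [Field k] [CharZero k] (K0 K1 K2 K3 K4 K5 K6 K7 K8 K9 K10 K11 : k)
    (h : ∀ x y z : k, K0*x^3+K1*(x^2*y*z)+K2*(x^2*z^3)+K3*(x*y^3)+K4*(x*y^2*z^2)+K5*(x*y*z^4)
      +K6*(x*z^6)+K7*(y^4*z)+K8*(y^3*z^3)+K9*(y^2*z^5)+K10*(y*z^7)+K11*z^9 = 0) :
    K0 = 0 ∧ K1 = 0 ∧ K2 = 0 ∧ K3 = 0 ∧ K4 = 0 ∧ K7 = 0 := by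
  have cub : ∀ a b c d : k, (∀ x, a + b*x + c*x^2 + d*x^3 = 0) → a = 0 ∧ b = 0 ∧ c = 0 ∧ d = 0 := by
    intro a b c d H
    have h0 := H 0
    have h1 := H 1
    have h2 := H (-1)
    have h3 := H 2
    refine ⟨?_, ?_, ?_, ?_⟩ <;> grind
  have quar : ∀ a b c d e : k, (∀ x, a + b*x + c*x^2 + d*x^3 + e*x^4 = 0) → e = 0 := by
    intro a b c d e H
    have h0 := H 0
    have h1 := H 1
    have h2 := H (-1)
    have h3 := H 2
    have h4 := H (-2)
    grind
  have A : ∀ y, _ := fun y => cub (K11 + K10*y + K9*y^2+K8*y^3+K7*y^4) (K6+K5*y+K4*y^2+K3*y^3)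
    (K2+K1*y) K0 (fun x => by linear_combination h x y 1)
  have B := cub _ _ _ _ (fun y => (A y).2.1)
  have D := quar _ _ _ _ _ (fun y => (A y).1)
  have E := cub K2 K1 0 0 (fun y => by linear_combination (A y).2.2.1)
  exact ⟨(A 0).2.2.2, E.2.1, E.1, B.2.2.2, B.2.2.1, D⟩

lemma aux_core {k : Type*} [Field k] [CharZero k] (p q r s k2 k4 k5 k6 k8 k9 k10 k11 : k)
    (hp : p ≠ 0) (hq : q ≠ 0) (hdet : 3 * p * s - q * r ≠ 0) (a b c d e u l : k) (hl : l ≠ 0)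
    (F : k → k → k → k)
    (hF : ∀ x y z, F x y z = p*x^3+r*(x^2*y*z)+k2*(x^2*z^3)+q*(x*y^3)+k4*(x*y^2*z^2)+k5*(x*y*z^4)
      +k6*(x*z^6)+s*(y^4*z)+k8*(y^3*z^3)+k9*(y^2*z^5)+k10*(y*z^7)+k11*z^9)
    (h : ∀ x y z, F (a*x+b*(y*z)+c*z^3) (d*y+e*z^2) (u*z) = l * F x y z) :
    u ≠ 0 ∧ a = u ^ 3 ∧ d = u ^ 2 ∧ l = u ^ 9 ∧ b = 0 ∧ c = 0 ∧ e = 0 := by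
  simp only [hF] at h
  obtain ⟨h0, h1, h2, h3, h4, h7⟩ := aux_poly
    (a^3*p - l*p)
    (3*a^2*b*p + a^2*d*u*r - l*r)
    (3*a^2*c*p + a^2*e*u*r + a^2*u^3*k2 - l*k2)
    (a*d^3*q - l*q)
    (3*a*b^2*p + 2*a*b*d*u*r + 3*a*d^2*e*q + a*d^2*u^2*k4 - l*k4)
    (6*a*b*c*p + 2*a*b*e*u*r + 2*a*c*d*u*r + 2*a*b*u^3*k2 + 3*a*d*e^2*q + 2*a*d*e*u^2*k4 + a*d*u^4*k5 - l*k5)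
    (3*a*c^2*p + 2*a*c*e*u*r + 2*a*c*u^3*k2 + a*e^3*q + a*e^2*u^2*k4 + a*e*u^4*k5 + a*u^6*k6 - l*k6)
    (b*d^3*q + d^4*u*s - l*s)
    (b^3*p + b^2*d*u*r + 3*b*d^2*e*q + c*d^3*q + b*d^2*u^2*k4 + 4*d^3*e*u*s + d^3*u^3*k8 - l*k8)
    (3*b^2*c*p + b^2*e*u*r + 2*b*c*d*u*r + b^2*u^3*k2 + 3*b*d*e^2*q + 3*c*d^2*e*q + 2*b*d*e*u^2*k4 + c*d^2*u^2*k4 + b*d*u^4*k5 + 6*d^2*e^2*u*s + 3*d^2*e*u^3*k8 + d^2*u^5*k9 - l*k9)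
    (3*b*c^2*p + 2*b*c*e*u*r + c^2*d*u*r + 2*b*c*u^3*k2 + b*e^3*q + 3*c*d*e^2*q + b*e^2*u^2*k4 + 2*c*d*e*u^2*k4 + b*e*u^4*k5 + c*d*u^4*k5 + b*u^6*k6 + 4*d*e^3*u*s + 3*d*e^2*u^3*k8 + 2*d*e*u^5*k9 + d*u^7*k10 - l*k10)
    (c^3*p + c^2*e*u*r + c^2*u^3*k2 + c*e^3*q + c*e^2*u^2*k4 + c*e*u^4*k5 + c*u^6*k6 + e^4*u*s + e^3*u^3*k8 + e^2*u^5*k9 + e*u^7*k10 + u^9*k11 - l*k11)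
    (fun x y z => by linear_combination h x y z)
  have ha3 : a ^ 3 = l := mul_left_cancel₀ hp (by linear_combination h0)
  have had : a * d ^ 3 = l := mul_left_cancel₀ hq (by linear_combination h3)
  have ha : a ≠ 0 := by rintro rfl; apply hl; rw [← ha3]; ring
  have hd : d ≠ 0 := by rintro rfl; apply hl; rw [← had]; ring
  have h23 : a ^ 2 = d ^ 3 := mul_left_cancel₀ ha (by linear_combination ha3 - had)
  have e1 : 3 * b * p = r * (a - d * u) :=
    mul_left_cancel₀ (pow_ne_zero 2 ha) (by linear_combination h1 - r * ha3)
  have e2 : b * q = s * (a - d * u) :=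
    mul_left_cancel₀ (pow_ne_zero 3 hd) (by linear_combination h7 - s * had)
  have hau : a = d * u := by
    have : (3 * p * s - q * r) * (a - d * u) = 0 := by linear_combination q * e1 - 3 * p * e2
    rcases mul_eq_zero.mp this with h | h
    · exact absurd h hdet
    · linear_combination h
  have hb : b = 0 := by
    have : b * q = 0 := by rw [e2, hau]; ring
    exact (mul_eq_zero.mp this).resolve_right hq
  have hdu : d = u ^ 2 := by
    have : d ^ 2 * d = d ^ 2 * u ^ 2 := by rw [hau] at h23; linear_combination -h23
    exact mul_left_cancel₀ (pow_ne_zero 2 hd) this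
  have hau3 : a = u ^ 3 := by rw [hau, hdu]; ring
  have hu : u ≠ 0 := by rintro rfl; apply hd; rw [hdu]; ring
  have hl9 : l = u ^ 9 := by rw [← ha3, hau3]; ring
  have he : e = 0 := by
    subst hb hdu hau3 hl9
    have : (3 * q * u ^ 7) * e = 0 := by linear_combination h4
    exact (mul_eq_zero.mp this).resolve_left (by simp [hq, hu])
  have hc : c = 0 := by
    subst hb hdu hau3 hl9 he
    have : (3 * p * u ^ 6) * c = 0 := by linear_combination h2
    exact (mul_eq_zero.mp this).resolve_left (by simp [hp, hu])
  exact ⟨hu, hau3, hdu, hl9, hb, hc, he⟩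

lemma aux_span {σ k B ι : Type*} [Field k] [CommRing B] [Algebra k B] [Fintype ι] (w : σ → ℕ) (d : ℕ)
    (P : MvPolynomial σ k) (hP : P.IsWeightedHomogeneous w d) (φ : MvPolynomial σ k →ₐ[k] B)
    (v : ι → B) (h : ∀ s : σ →₀ ℕ, Finsupp.weight w s = d → ∃ i, φ (monomial s 1) = v i) :
    ∃ c : ι → k, ∑ i, c i • v i = φ P := by
  rw [← Submodule.mem_span_range_iff_exists_fun k]
  rw [P.as_sum, map_sum]
  refine Submodule.sum_mem _ fun s hs => ?_
  obtain ⟨i, hi⟩ := h s (hP (mem_support_iff.mp hs))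
  have : monomial s (coeff s P) = coeff s P • monomial s (1 : k) := by
    rw [smul_monomial]; simp
  rw [this, map_smul, hi]
  exact Submodule.smul_mem _ _ (Submodule.subset_span ⟨i, rfl⟩)

lemma aux_f {k : Type*} [Field k] (f : MvPolynomial (Fin 3) k)
    (hf : f.IsWeightedHomogeneous w3 9) : ∃ c : Fin 12 → k,
    f = C (c 0)*X 0^3+C (c 1)*(X 0^2*X 1*X 2)+C (c 2)*(X 0^2*X 2^3)+C (c 3)*(X 0*X 1^3)
      +C (c 4)*(X 0*X 1^2*X 2^2)+C (c 5)*(X 0*X 1*X 2^4)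
      +C (c 6)*(X 0*X 2^6)+C (c 7)*(X 1^4*X 2)+C (c 8)*(X 1^3*X 2^3)+C (c 9)*(X 1^2*X 2^5)
      +C (c 10)*(X 1*X 2^7)+C (c 11)*X 2^9 := by
  obtain ⟨c, hc⟩ := aux_span w3 9 f hf (AlgHom.id k _)
    (![X 0^3, X 0^2*X 1*X 2, X 0^2*X 2^3, X 0*X 1^3, X 0*X 1^2*X 2^2, X 0*X 1*X 2^4,
      X 0*X 2^6, X 1^4*X 2, X 1^3*X 2^3, X 1^2*X 2^5, X 1*X 2^7, X 2^9] :
        Fin 12 → MvPolynomial (Fin 3) k) (by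
    intro s hs
    have hs' : s 0 * 3 + s 1 * 2 + s 2 = 9 := by
      rw [Finsupp.weight_apply, Finsupp.sum_fintype _ _ (by simp)] at hs
      simpa [Fin.sum_univ_three, w3] using hs
    have hm : (monomial s (1 : k)) = X 0 ^ s 0 * X 1 ^ s 1 * X 2 ^ s 2 := by
      rw [monomial_eq, Finsupp.prod_fintype _ _ (by simp), Fin.prod_univ_three]; simp
    rw [AlgHom.id_apply, hm]
    generalize s 0 = a at *
    generalize s 1 = b at *
    obtain ⟨c, hc⟩ : ∃ c, c = s 2 := ⟨_, rfl⟩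
    rw [← hc] at hs' ⊢
    have ha : a ≤ 3 := by omega
    have hb : b ≤ 4 := by omega
    obtain rfl : c = 9 - a * 3 - b * 2 := by omega
    interval_cases a <;> interval_cases b <;> first | omega | skip
    · exact ⟨11, by simp⟩
    · exact ⟨10, by simp⟩
    · exact ⟨9, by simp⟩
    · exact ⟨8, by simp⟩
    · exact ⟨7, by simp⟩
    · exact ⟨6, by simp⟩
    · exact ⟨5, by simp⟩
    · exact ⟨4, by simp⟩
    · exact ⟨3, by simp⟩
    · exact ⟨2, by simp⟩
    · exact ⟨1, by simp⟩
    · exact ⟨0, by simp⟩)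
  refine ⟨c, ?_⟩
  rw [AlgHom.id_apply] at hc
  conv_lhs => rw [← hc]
  simp [Fin.sum_univ_succ, smul_eq_C_mul]
  ring

lemma aux_eig {k M : Type*} [Field k] [CharZero k] [AddCommGroup M] [Module k M]
    (T : M →ₗ[k] M) (N d : ℕ) (v : ℕ → M) (hv : ∀ i, T (v i) = (2:k) ^ i • v i)
    (hs : ∀ i, i ∉ Finset.range N → v i = 0) (a : M) (ha : a = ∑ i ∈ Finset.range N, v i)
    (hT : T a = (2:k) ^ d • a) : a = v d := by
  have inj : Function.Injective (fun i : ℕ => (2:k) ^ i) := by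
    intro i j h
    have h' : (2:k) ^ i = 2 ^ j := h
    have : (2:ℕ) ^ i = 2 ^ j := by exact_mod_cast h'
    exact Nat.pow_right_injective le_rfl this
  have key : ∀ q : Polynomial k, ∀ (c : k) (m : M), T m = c • m →
      Polynomial.aeval (R := k) (A := Module.End k M) T q m = q.eval c • m := by
    intro q c m hm
    induction q using Polynomial.induction_on' with
    | add p q hp hq => simp [hp, hq, add_smul]
    | monomial n b =>
      have : ∀ n, ((T : Module.End k M) ^ n) m = c ^ n • m := by
        intro n
        induction n with
        | zero => simp
        | succ n ih => rw [pow_succ', Module.End.mul_apply, ih, map_smul, hm, smul_smul, pow_succ]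
      simp [Polynomial.aeval_monomial, this, smul_smul, mul_comm]
  set q : Polynomial k := ∏ i ∈ (Finset.range N).erase d, (Polynomial.X - Polynomial.C ((2:k)^i)) with hq
  have h1 := key q _ _ hT
  have h2 : Polynomial.aeval (R := k) (A := Module.End k M) T q a = q.eval (2^d) • v d := by
    rw [ha, map_sum, Finset.sum_eq_single d]
    · exact key q _ _ (hv d)
    · intro i hi hid
      rw [key q _ _ (hv i), hq, Polynomial.eval_prod,
        Finset.prod_eq_zero (Finset.mem_erase.mpr ⟨hid, hi⟩) (by simp), zero_smul]
    · intro h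
      rw [hs d h, map_zero]
  rw [h1] at h2
  refine smul_right_injective M (r := q.eval (2^d)) ?_ h2
  rw [hq, Polynomial.eval_prod, Finset.prod_ne_zero_iff]
  intro i hi
  simp only [Polynomial.eval_sub, Polynomial.eval_X, Polynomial.eval_C]
  exact sub_ne_zero.mpr fun h => (Finset.mem_erase.mp hi).1 (inj h).symm

/-- weights on four variables -/
def w4 (n : ℕ) : Fin 4 → ℕ := ![3 * n, 2 * n, n, 9]

lemma aux_ext {k : Type} [Field k] {f : MvPolynomial (Fin 3) k} {n : ℕ} {B : Type*} [CommRing B]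
    [Algebra k B] (φ ψ : QuotRingMinus k f n →ₐ[k] B)
    (h : ∀ i, φ (genMinus k f n i) = ψ (genMinus k f n i)) : φ = ψ := by
  apply Ideal.Quotient.algHom_ext
  apply MvPolynomial.algHom_ext
  intro i
  exact h i

lemma aux_rel {k : Type} [Field k] (f : MvPolynomial (Fin 3) k) (n : ℕ) :
    genMinus k f n 3 ^ n = aeval (fun i : Fin 3 => genMinus k f n i.castSucc) f := by
  have h : Ideal.Quotient.mk (relIdealMinus k f n) (X 3 ^ n - rename Fin.castSucc f) = 0 :=
    Ideal.Quotient.eq_zero_iff_mem.mpr (Ideal.subset_span rfl)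
  rw [map_sub, map_pow, sub_eq_zero] at h
  rw [genMinus, h]
  have : (Ideal.Quotient.mkₐ k (relIdealMinus k f n)).comp (rename Fin.castSucc) =
     aeval (fun i : Fin 3 => genMinus k f n i.castSucc) := by
    apply MvPolynomial.algHom_ext
    intro i
    simp [genMinus]
  exact DFunLike.congr_fun this f

/-- lifting -/
lemma aux_lift {k : Type} [Field k] (f : MvPolynomial (Fin 3) k) (n : ℕ) {B : Type*} [CommRing B]
    [Algebra k B] (g : Fin 4 → B) (h : g 3 ^ n = aeval (fun i : Fin 3 => g i.castSucc) f) :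
    ∃ φ : QuotRingMinus k f n →ₐ[k] B, ∀ i, φ (genMinus k f n i) = g i := by
  refine ⟨Ideal.Quotient.liftₐ (relIdealMinus k f n) (aeval g) ?_, ?_⟩
  · intro a ha
    rw [relIdealMinus, Ideal.mem_span_singleton] at ha
    obtain ⟨b, rfl⟩ := ha
    rw [map_mul, map_sub, map_pow, aeval_X, aeval_rename, h]
    simp [Function.comp_def]
  · intro i
    have : Ideal.Quotient.lift (relIdealMinus k f n) (aeval g : MvPolynomial (Fin 4) k →ₐ[k] B).toRingHom
      (by
        intro a ha
        rw [relIdealMinus, Ideal.mem_span_singleton] at ha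
        obtain ⟨b, rfl⟩ := ha
        simp only [AlgHom.toRingHom_eq_coe, RingHom.coe_coe]
        rw [map_mul, map_sub, map_pow, aeval_X, aeval_rename, h]
        simp [Function.comp_def]) (Ideal.Quotient.mk _ (X i)) = g i := by
      rw [Ideal.Quotient.lift_mk]
      simp
    exact this

lemma aux_torus {k : Type} [Field k] (f : MvPolynomial (Fin 3) k)
    (hf : f.IsWeightedHomogeneous w3 9) (n : ℕ) (t : k) (ht : t ≠ 0) :
    ∃ β : QuotRingMinus k f n ≃ₐ[k] QuotRingMinus k f n,
      ∀ i, β (genMinus k f n i) = t ^ (w4 n i) • genMinus k f n i := by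
  have H : ∀ t : k, ∃ φ : QuotRingMinus k f n →ₐ[k] QuotRingMinus k f n,
      ∀ i, φ (genMinus k f n i) = t ^ (w4 n i) • genMinus k f n i := by
    intro t
    refine aux_lift f n _ ?_
    have := aux_hom w3 9 f hf (t ^ n) (fun i : Fin 3 => genMinus k f n i.castSucc)
    rw [← aux_rel] at this
    rw [smul_pow, ← pow_mul]
    have e1 : t ^ (w4 n 3 * n) = (t ^ n) ^ 9 := by
      simp [w4, ← pow_mul, mul_comm]
    have e2 : (fun i : Fin 3 => t ^ (w4 n i.castSucc) • genMinus k f n i.castSucc) =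
        fun i : Fin 3 => (t ^ n) ^ w3 i • genMinus k f n i.castSucc := by
      funext i
      congr 1
      fin_cases i <;> simp [w4, w3, ← pow_mul, mul_comm]
    rw [e1, e2, this]
  obtain ⟨φ, hφ⟩ := H t
  obtain ⟨ψ, hψ⟩ := H t⁻¹
  refine ⟨AlgEquiv.ofAlgHom φ ψ (aux_ext _ _ fun i => ?_) (aux_ext _ _ fun i => ?_), hφ⟩
  · simp [hφ, hψ, smul_smul, ← mul_pow, ht]
  · simp [hφ, hψ, smul_smul, ← mul_pow, ht]

lemma aux_inTorus {k : Type} [Field k] (f : MvPolynomial (Fin 3) k) (n : ℕ)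
    (α : QuotRingMinus k f n ≃ₐ[k] QuotRingMinus k f n) :
    InTorusMinus k f n α ↔ ∃ t : kˣ, ∀ i, α (genMinus k f n i) = (t : k) ^ (w4 n i) • genMinus k f n i := by
  simp [InTorusMinus, Fin.forall_fin_succ, w4]

/-- an eigenvector is the class of a homogeneous polynomial -/
lemma aux_homog {k : Type} [Field k] [CharZero k] (f : MvPolynomial (Fin 3) k) (n : ℕ)
    (β : QuotRingMinus k f n ≃ₐ[k] QuotRingMinus k f n)
    (hβ : ∀ i, β (genMinus k f n i) = (2 : k) ^ (w4 n i) • genMinus k f n i)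
    (a : QuotRingMinus k f n) (d : ℕ) (ha : β a = (2 : k) ^ d • a) :
    ∃ P : MvPolynomial (Fin 4) k, P.IsWeightedHomogeneous (w4 n) d ∧
      aeval (genMinus k f n) P = a := by
  have hsurj : ∃ P : MvPolynomial (Fin 4) k, aeval (genMinus k f n) P = a := by
    obtain ⟨P, hP⟩ := Ideal.Quotient.mk_surjective a
    refine ⟨P, ?_⟩
    rw [← hP]
    have : aeval (genMinus k f n) = (Ideal.Quotient.mkₐ k (relIdealMinus k f n)) := by
      apply MvPolynomial.algHom_ext
      intro i
      simp [genMinus]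
    rw [this]; rfl
  obtain ⟨P, hP⟩ := hsurj
  refine ⟨weightedHomogeneousComponent (w4 n) d P,
    weightedHomogeneousComponent_isWeightedHomogeneous _ _, ?_⟩
  symm
  refine aux_eig (M := QuotRingMinus k f n) β.toLinearMap (weightedTotalDegree (w4 n) P + 1) d
    (fun i => aeval (genMinus k f n) (weightedHomogeneousComponent (w4 n) i P)) ?_ ?_ a ?_ ha
  · intro i
    rw [← aux_hom (w4 n) i _ (weightedHomogeneousComponent_isWeightedHomogeneous _ _)]
    have : β.toAlgHom.comp (aeval (genMinus k f n)) =
        aeval (fun i => (2 : k) ^ (w4 n i) • genMinus k f n i) := by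
      apply MvPolynomial.algHom_ext
      intro i
      simp [hβ]
    exact DFunLike.congr_fun this _
  · intro i hi
    rw [weightedHomogeneousComponent_eq_zero, map_zero]
    simp at hi
    omega
  · rw [← hP, ← map_sum]
    congr 1
    conv_lhs => rw [← sum_weightedHomogeneousComponent (w4 n) P]
    rw [finsum_eq_sum_of_support_subset]
    intro i hi
    by_contra h
    apply hi
    apply weightedHomogeneousComponent_eq_zero
    simp at h
    omega

lemma aux_w4 (n : ℕ) (s : Fin 4 →₀ ℕ) :
    Finsupp.weight (w4 n) s = s 0 * (3 * n) + s 1 * (2 * n) + s 2 * n + s 3 * 9 := by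
  rw [Finsupp.weight_apply, Finsupp.sum_fintype _ _ (by simp)]
  simp [Fin.sum_univ_four, w4]

lemma aux_wt1 (n m : ℕ) (hn : 0 < n) (hn3 : ¬ 3 ∣ n) (hm : m < 9) (a b c j : ℕ)
    (h : a * (3 * n) + b * (2 * n) + c * n + j * 9 = m * n) : j = 0 ∧ 3 * a + 2 * b + c = m := by
  have hcop : Nat.Coprime n 9 := by
    have h3 : Nat.Coprime 3 n := (Nat.Prime.coprime_iff_not_dvd Nat.prime_three).mpr hn3
    exact (Nat.Coprime.pow_left 2 h3).symm
  have hd : n ∣ j * 9 := by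
    have h1 : n ∣ a * (3 * n) + b * (2 * n) + c * n := ⟨3 * a + 2 * b + c, by ring⟩
    have h2 : n ∣ a * (3 * n) + b * (2 * n) + c * n + j * 9 := ⟨m, by rw [h]; ring⟩
    exact (Nat.dvd_add_right h1).mp h2
  obtain ⟨i, rfl⟩ := hcop.dvd_of_dvd_mul_right hd
  have h' : n * (3 * a + 2 * b + c + 9 * i) = n * m := by linarith
  have h'' := Nat.eq_of_mul_eq_mul_left hn h'
  have : i = 0 := by omega
  subst this
  simpa using h''

lemma aux_wt2 (n : ℕ) (hn : 2 ≤ n) (hn3 : ¬ 3 ∣ n) (a b c j : ℕ)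
    (h : a * (3 * n) + b * (2 * n) + c * n + j * 9 = 9) : j = 1 ∧ a = 0 ∧ b = 0 ∧ c = 0 := by
  have hcop : Nat.Coprime n 9 := by
    have h3 : Nat.Coprime 3 n := (Nat.Prime.coprime_iff_not_dvd Nat.prime_three).mpr hn3
    exact (Nat.Coprime.pow_left 2 h3).symm
  have h0 : n * (3 * a + 2 * b + c) + 9 * j = 9 := by linarith
  have hd : 9 ∣ n * (3 * a + 2 * b + c) := by omega
  obtain ⟨i, hi⟩ := hcop.symm.dvd_of_dvd_mul_left hd
  rw [hi] at h0
  have hi0 : i = 0 := by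
    by_contra hne
    have : 2 * 1 ≤ n * i := Nat.mul_le_mul hn (by omega)
    nlinarith
  subst hi0
  omega

lemma aux_mon {k : Type*} [Field k] {B : Type*} [CommRing B] [Algebra k B] (g : Fin 4 → B)
    (s : Fin 4 →₀ ℕ) : aeval g (monomial s (1:k)) =
      g 0 ^ s 0 * g 1 ^ s 1 * g 2 ^ s 2 * g 3 ^ s 3 := by
  rw [aeval_monomial, Finsupp.prod_fintype _ _ (by simp), Fin.prod_univ_four]; simp

lemma aux_forms {k : Type} [Field k] [CharZero k] (f : MvPolynomial (Fin 3) k)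
    (hf9 : f.IsWeightedHomogeneous w3 9) (n : ℕ) (hn2 : 2 ≤ n) (hn3 : ¬ (3 ∣ n))
    (α : QuotRingMinus k f n ≃ₐ[k] QuotRingMinus k f n)
    (h : ∀ β : QuotRingMinus k f n ≃ₐ[k] QuotRingMinus k f n,
        InTorusMinus k f n β → α * β = β * α) :
    ∃ a b c d e u v : k,
      α (genMinus k f n 0) = a • genMinus k f n 0 + b • (genMinus k f n 1 * genMinus k f n 2)
        + c • genMinus k f n 2 ^ 3 ∧
      α (genMinus k f n 1) = d • genMinus k f n 1 + e • genMinus k f n 2 ^ 2 ∧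
      α (genMinus k f n 2) = u • genMinus k f n 2 ∧
      α (genMinus k f n 3) = v • genMinus k f n 3 := by
  obtain ⟨β, hβ⟩ := aux_torus f hf9 n 2 two_ne_zero
  have hβT : InTorusMinus k f n β := (aux_inTorus f n β).mpr ⟨Units.mk0 2 two_ne_zero, hβ⟩
  have hcomm := h β hβT
  have key : ∀ i, ∃ P : MvPolynomial (Fin 4) k, P.IsWeightedHomogeneous (w4 n) (w4 n i) ∧
      aeval (genMinus k f n) P = α (genMinus k f n i) := by
    intro i
    refine aux_homog f n β hβ _ _ ?_
    have := DFunLike.congr_fun hcomm (genMinus k f n i)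
    rw [AlgEquiv.mul_apply, AlgEquiv.mul_apply, hβ, map_smul] at this
    exact this.symm
  have hpos : 0 < n := by omega
  generalize hg : genMinus k f n = g at *
  obtain ⟨P0, h0, e0⟩ := key 0
  obtain ⟨P1, h1, e1⟩ := key 1
  obtain ⟨P2, h2, e2⟩ := key 2
  obtain ⟨P3, h3, e3⟩ := key 3
  obtain ⟨c0, f0⟩ := aux_span _ _ P0 h0 (aeval g) ![g 0, g 1 * g 2, g 2 ^ 3] (by
    intro s hs
    rw [aux_w4] at hs
    obtain ⟨hj, hm⟩ := aux_wt1 n 3 hpos hn3 (by norm_num) _ _ _ _ hs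
    rw [aux_mon, hj]
    obtain ⟨q0, q1, q2⟩ | ⟨q0, q1, q2⟩ | ⟨q0, q1, q2⟩ : (s 0 = 1 ∧ s 1 = 0 ∧ s 2 = 0) ∨
      (s 0 = 0 ∧ s 1 = 1 ∧ s 2 = 1) ∨ (s 0 = 0 ∧ s 1 = 0 ∧ s 2 = 3) := by omega
    · exact ⟨0, by simp [q0, q1, q2]⟩
    · exact ⟨1, by simp [q0, q1, q2]⟩
    · exact ⟨2, by simp [q0, q1, q2]⟩)
  obtain ⟨c1, f1⟩ := aux_span _ _ P1 h1 (aeval g) ![g 1, g 2 ^ 2] (by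
    intro s hs
    rw [aux_w4] at hs
    obtain ⟨hj, hm⟩ := aux_wt1 n 2 hpos hn3 (by norm_num) _ _ _ _ hs
    rw [aux_mon, hj]
    obtain ⟨q0, q1, q2⟩ | ⟨q0, q1, q2⟩ : (s 0 = 0 ∧ s 1 = 1 ∧ s 2 = 0) ∨
      (s 0 = 0 ∧ s 1 = 0 ∧ s 2 = 2) := by omega
    · exact ⟨0, by simp [q0, q1, q2]⟩
    · exact ⟨1, by simp [q0, q1, q2]⟩)
  obtain ⟨c2, f2⟩ := aux_span _ _ P2 h2 (aeval g) ![g 2] (by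
    intro s hs
    rw [aux_w4] at hs
    obtain ⟨hj, hm⟩ := aux_wt1 n 1 hpos hn3 (by norm_num) _ _ _ _ (hs.trans (one_mul n).symm)
    rw [aux_mon, hj]
    obtain ⟨q0, q1, q2⟩ : (s 0 = 0 ∧ s 1 = 0 ∧ s 2 = 1) := by omega
    exact ⟨0, by simp [q0, q1, q2]⟩)
  obtain ⟨c3, f3⟩ := aux_span _ _ P3 h3 (aeval g) ![g 3] (by
    intro s hs
    rw [aux_w4] at hs
    obtain ⟨hj, q0, q1, q2⟩ := aux_wt2 n hn2 hn3 _ _ _ _ hs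
    rw [aux_mon, hj]
    exact ⟨0, by simp [q0, q1, q2]⟩)
  refine ⟨c0 0, c0 1, c0 2, c1 0, c1 1, c2 0, c3 0, ?_, ?_, ?_, ?_⟩
  · rw [← e0, ← f0]; simp [Fin.sum_univ_three]
  · rw [← e1, ← f1]; simp
  · rw [← e2, ← f2]; simp
  · rw [← e3, ← f3]; simp

lemma aux_root {k : Type*} [Field k] [IsAlgClosed k] (n : ℕ) (hn : 0 < n) (hn3 : ¬ 3 ∣ n)
    (u v : k) (hu : u ≠ 0) (h : v ^ n = u ^ 9) : ∃ t : k, t ≠ 0 ∧ t ^ n = u ∧ t ^ 9 = v := by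
  obtain ⟨τ, hτ⟩ := IsAlgClosed.exists_pow_nat_eq u hn
  have hτ0 : τ ≠ 0 := by rintro rfl; rw [zero_pow hn.ne'] at hτ; exact hu hτ.symm
  have hcop : Nat.Coprime 9 n := by
    have h3 : Nat.Coprime 3 n := (Nat.Prime.coprime_iff_not_dvd Nat.prime_three).mpr hn3
    exact Nat.Coprime.pow_left 2 h3
  obtain ⟨i, j, hij⟩ : ∃ i j : ℤ, 9 * i + n * j = 1 := by
    have := Nat.isCoprime_iff_coprime.mpr hcop
    obtain ⟨i, j, h⟩ := this
    exact ⟨i, j, by push_cast at h; linarith⟩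
  set ζ := v / τ ^ 9 with hζ
  have hv0 : v ≠ 0 := by
    rintro rfl
    rw [zero_pow hn.ne'] at h
    exact pow_ne_zero 9 hu h.symm
  have hζ0 : ζ ≠ 0 := div_ne_zero hv0 (pow_ne_zero _ hτ0)
  have hζn : ζ ^ n = 1 := by
    rw [hζ, div_pow, h, ← hτ, ← pow_mul, ← pow_mul, mul_comm, div_self (pow_ne_zero _ hτ0)]
  have z1 : (ζ ^ i) ^ n = 1 := by
    rw [← zpow_natCast, ← zpow_mul, mul_comm, zpow_mul, zpow_natCast, hζn, one_zpow]
  have z2 : (ζ ^ i) ^ 9 = ζ := by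
    have e : ζ ^ (9 * i + n * j) = ζ := by rw [hij, zpow_one]
    rw [zpow_add₀ hζ0, zpow_mul ζ (n:ℤ) j, zpow_natCast, hζn, one_zpow, mul_one] at e
    rw [← zpow_natCast, ← zpow_mul, mul_comm]
    exact_mod_cast e
  refine ⟨ζ ^ i * τ, mul_ne_zero (zpow_ne_zero _ hζ0) hτ0, ?_, ?_⟩
  · rw [mul_pow, z1, hτ, one_mul]
  · rw [mul_pow, z2, hζ, div_mul_cancel₀ _ (pow_ne_zero _ hτ0)]

lemma aux_main (k : Type) [Field k] [IsAlgClosed k] [CharZero k]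
    (f : MvPolynomial (Fin 3) k)
    (hf9 : f.IsWeightedHomogeneous w3 9)
    (hC34 : CondC3C4 k f)
    (n : ℕ) (hn2 : 2 ≤ n) (hn3 : ¬ (3 ∣ n))
    (α : QuotRingMinus k f n ≃ₐ[k] QuotRingMinus k f n)
    (h : ∀ β : QuotRingMinus k f n ≃ₐ[k] QuotRingMinus k f n,
        InTorusMinus k f n β → α * β = β * α) : InTorusMinus k f n α := by
  have hpos : 0 < n := by omega
  obtain ⟨a, b, c, d, e, u, v, ea, ed, eu, ev⟩ := aux_forms f hf9 n hn2 hn3 α h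
  obtain ⟨K, hK⟩ := aux_f f hf9
  obtain ⟨p, q, r, s, hp, hq, H3, H4, hdet⟩ := hC34
  have H3' : ∀ x y : k, K 0 * x ^ 3 + K 3 * (x * y ^ 3) = x * (p * x ^ 2 + q * y ^ 3) := by
    intro x y
    have := congrArg (eval (fun i : ℕ => if i = 0 then x else y)) H3
    rw [hK] at this
    simpa using this
  have H4' : ∀ x y : k, K 1 * (x ^ 2 * y) + K 7 * (y ^ 4) = y * (r * x ^ 2 + s * y ^ 3) := by
    intro x y
    have := congrArg (eval (fun i : ℕ => if i = 0 then x else y)) H4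
    rw [hK] at this
    simpa [pderiv_X, Pi.single_apply] using this
  have k0 : K 0 = p := by simpa using H3' 1 0
  have k3 : K 3 = q := by simpa [k0] using H3' 1 1
  have k7 : K 7 = s := by simpa using H4' 0 1
  have k1 : K 1 = r := by simpa [k7] using H4' 1 1
  set F : k → k → k → k := fun x y z => eval ![x, y, z] f with hFdef
  have hF : ∀ x y z, F x y z = p*x^3+r*(x^2*y*z)+K 2*(x^2*z^3)+q*(x*y^3)+K 4*(x*y^2*z^2)
      +K 5*(x*y*z^4)+K 6*(x*z^6)+s*(y^4*z)+K 8*(y^3*z^3)+K 9*(y^2*z^5)+K 10*(y*z^7)+K 11*z^9 := by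
    intro x y z
    rw [hFdef]
    simp only
    rw [hK]
    simp [k0, k1, k3, k7]
  -- points
  have pt : ∀ x y z : k, ∃ (W : k) (φ : QuotRingMinus k f n →ₐ[k] k), W ^ n = F x y z ∧
      φ (genMinus k f n 0) = x ∧ φ (genMinus k f n 1) = y ∧ φ (genMinus k f n 2) = z ∧
      φ (genMinus k f n 3) = W := by
    intro x y z
    obtain ⟨W, hW⟩ := IsAlgClosed.exists_pow_nat_eq (F x y z) hpos
    obtain ⟨φ, hφ⟩ := aux_lift f n ![x, y, z, W] (by
      have : (fun i : Fin 3 => (![x, y, z, W] : Fin 4 → k) i.castSucc) = ![x, y, z] := by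
        funext i; fin_cases i <;> rfl
      rw [this]
      exact hW)
    exact ⟨W, φ, hW, hφ 0, hφ 1, hφ 2, hφ 3⟩
  have hv : v ≠ 0 := by
    rintro rfl
    rw [zero_smul] at ev
    have : genMinus k f n 3 = 0 := (map_eq_zero_iff α α.injective).mp ev
    obtain ⟨W, φ, hW, -, -, -, h3⟩ := pt 1 0 0
    rw [this, map_zero] at h3
    rw [← h3, hF, zero_pow hpos.ne'] at hW
    apply hp
    simpa using hW.symm
  have hinv : ∀ x y z, F (a*x+b*(y*z)+c*z^3) (d*y+e*z^2) (u*z) = v ^ n * F x y z := by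
    intro x y z
    obtain ⟨W, φ, hW, h0, h1, h2, h3⟩ := pt x y z
    have h4 := congrArg (fun t => φ (α t)) (aux_rel f n)
    simp only [map_pow, ev] at h4
    rw [map_smul, h3, smul_eq_mul, mul_pow, hW] at h4
    rw [h4]
    have : (φ.comp α.toAlgHom).comp (aeval (fun i : Fin 3 => genMinus k f n i.castSucc)) =
        aeval ![a*x+b*(y*z)+c*z^3, d*y+e*z^2, u*z] := by
      apply MvPolynomial.algHom_ext
      intro i
      fin_cases i
      · simp [ea, h0, h1, h2]
      · simp [ed, h0, h1, h2]
      · simp [eu, h0, h1, h2]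
    exact (DFunLike.congr_fun this f).symm
  obtain ⟨hu, ha, hd, hl, hb, hc, he⟩ := aux_core p q r s (K 2) (K 4) (K 5) (K 6) (K 8) (K 9) (K 10) (K 11)
    hp hq hdet a b c d e u (v ^ n) (pow_ne_zero _ hv) F hF hinv
  obtain ⟨t, ht, ht1, ht2⟩ := aux_root n hpos hn3 u v hu hl
  refine ⟨Units.mk0 t ht, ?_, ?_, ?_, ?_⟩
  · rw [ea, hb, hc, ha, ← ht1, Units.val_mk0, ← pow_mul, mul_comm n 3]; simp
  · rw [ed, he, hd, ← ht1, Units.val_mk0, ← pow_mul, mul_comm n 2]; simp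
  · rw [eu, ← ht1, Units.val_mk0]
  · rw [ev, ← ht2, Units.val_mk0]

/-- Lemma 3.7 (centralizer2): let `f ∈ R₉` satisfy (C1)-(C4), let `n ≥ 2` with `n ∉ 3ℤ`,
and let `A = R[W]/(Wⁿ - f)`. Then the centralizer of the subtorus `T = T(𝔊)` in
`Aut_k(A)` equals `T`: an automorphism commutes with all of `T` iff it belongs to `T`. -/
theorem statement_18 (k : Type) [Field k] [IsAlgClosed k] [CharZero k]
    (f : MvPolynomial (Fin 3) k)
    (hf9 : f.IsWeightedHomogeneous w3 9)
    (hC1 : Irreducible f)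
    (hC2 : CondC2 k f)
    (hC34 : CondC3C4 k f)
    (n : ℕ) (hn2 : 2 ≤ n) (hn3 : ¬ (3 ∣ n)) :
    ∀ α : QuotRingMinus k f n ≃ₐ[k] QuotRingMinus k f n,
      (∀ β : QuotRingMinus k f n ≃ₐ[k] QuotRingMinus k f n,
        InTorusMinus k f n β → α * β = β * α) ↔ InTorusMinus k f n α := by
  intro α
  refine ⟨aux_main k f hf9 hC34 n hn2 hn3 α, fun hα β hβ => ?_⟩
  obtain ⟨t, ht⟩ := (aux_inTorus f n α).mp hα
  obtain ⟨t', ht'⟩ := (aux_inTorus f n β).mp hβ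
  have : (α * β).toAlgHom = (β * α).toAlgHom := by
    apply aux_ext
    intro i
    change α (β (genMinus k f n i)) = β (α (genMinus k f n i))
    rw [ht, ht', map_smul, map_smul, ht, ht', smul_comm]
  ext x
  exact DFunLike.congr_fun this x
end
end

section
/- The polynomial F = x²z³ − 2xy²z² + y⁴z − 72x²yz + 8xy³ − 432x³ is a homogeneous element of R_9 and satisfies conditions (C1)–(C4): F is irreducible in R, the projective curve Proj(R/FR) has at least two singular points, F(x,y,0) = x(px² + qy³) with p, q ∈ k* (namely p = −432, q = 8), and ∂F/∂z(x,y,0) = y(rx² + sy³) with r, s ∈ k (namely r = −72, s = 1) satisfying 3ps − qr ≠ 0. -/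
open MvPolynomial

set_option synthInstance.maxHeartbeats 400000
set_option maxHeartbeats 1000000

noncomputable section

/-- The polynomial `F = x²z³ - 2xy²z² + y⁴z - 72x²yz + 8xy³ - 432x³` (with `x = X 0`,
`y = X 1`, `z = X 2`). -/
def cayleyF (k : Type) [Field k] : MvPolynomial (Fin 3) k :=
  X 0 ^ 2 * X 2 ^ 3 - C 2 * X 0 * X 1 ^ 2 * X 2 ^ 2 + X 1 ^ 4 * X 2
    - C 72 * X 0 ^ 2 * X 1 * X 2 + C 8 * X 0 * X 1 ^ 3 - C 432 * X 0 ^ 3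



lemma cubic_no_root (k : Type) [Field k] [CharZero k] (r : Polynomial k)
    (h : -432 * r ^ 3 + (1 - 72 * Polynomial.X) * r ^ 2
      + (8 * Polynomial.X ^ 3 - 2 * Polynomial.X ^ 2) * r + Polynomial.X ^ 4 = 0) : False := by
  have hd : r ∣ Polynomial.X ^ 4 :=
    ⟨432 * r ^ 2 - (1 - 72 * Polynomial.X) * r - (8 * Polynomial.X ^ 3 - 2 * Polynomial.X ^ 2),
      by linear_combination h⟩
  obtain ⟨j, hj, u, hu⟩ := (dvd_prime_pow Polynomial.prime_X 4).1 hd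
  obtain ⟨c, hc, hcu⟩ := Polynomial.isUnit_iff.1 (u⁻¹).isUnit
  have hr : r = Polynomial.C c * Polynomial.X ^ j := by
    rw [hcu, ← hu, mul_comm, mul_assoc]; simp
  have hc0 : c ≠ 0 := hc.ne_zero
  subst hr
  have key : ∀ (n : ℕ) (q : Polynomial k), Polynomial.X ^ n * q = 0 → q.eval 0 = 0 := by
    intro n q hq
    have : q = 0 := by
      rcases mul_eq_zero.1 hq with h | h
      · exact absurd h (pow_ne_zero _ Polynomial.X_ne_zero)
      · exact h
    simp [this]
  interval_cases j
  · have h1 := congrArg (fun p => Polynomial.coeff p 4) h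
    have : -432 * (Polynomial.C c * Polynomial.X ^ 0) ^ 3 + (1 - 72 * Polynomial.X) * (Polynomial.C c * Polynomial.X ^ 0) ^ 2
      + (8 * Polynomial.X ^ 3 - 2 * Polynomial.X ^ 2) * (Polynomial.C c * Polynomial.X ^ 0) + Polynomial.X ^ 4
      = Polynomial.C (-432 * c ^ 3 + c ^ 2) + Polynomial.C (-72 * c ^ 2) * Polynomial.X
        + Polynomial.C (-2 * c) * Polynomial.X ^ 2 + Polynomial.C (8 * c) * Polynomial.X ^ 3
        + Polynomial.X ^ 4 := by
      simp only [map_add, map_mul, map_neg, map_pow, map_ofNat]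
      ring
    rw [this] at h1
    simp only [Polynomial.coeff_add, Polynomial.coeff_C_mul, Polynomial.coeff_X_pow,
      Polynomial.coeff_C, Polynomial.coeff_X, Polynomial.coeff_zero] at h1
    norm_num at h1
  · have := key 2 (Polynomial.C c ^ 2 + Polynomial.X * (-432 * Polynomial.C c ^ 3
      - 72 * Polynomial.C c ^ 2 + 8 * Polynomial.C c * Polynomial.X - 2 * Polynomial.C c
      + Polynomial.X)) (by linear_combination h)
    simp [hc0] at this
  · have := key 4 ((Polynomial.C c - 1) ^ 2 + Polynomial.X * (-432 * Polynomial.C c ^ 3 * Polynomial.X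
      - 72 * Polynomial.C c ^ 2 + 8 * Polynomial.C c)) (by linear_combination h)
    have hc1 : c = 1 := by
      simp at this
      linear_combination this
    subst hc1
    have := key 5 (-432 * Polynomial.X - 64) (by
      rw [Polynomial.C_1] at h; linear_combination h)
    simp at this
  · have := key 4 (1 + Polynomial.X * (-432 * Polynomial.C c ^ 3 * Polynomial.X ^ 4
      + (1 - 72 * Polynomial.X) * Polynomial.C c ^ 2 * Polynomial.X
      + (8 * Polynomial.X - 2) * Polynomial.C c)) (by linear_combination h)
    simp at this
  · have := key 4 (1 + Polynomial.X * (-432 * Polynomial.C c ^ 3 * Polynomial.X ^ 7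
      + (1 - 72 * Polynomial.X) * Polynomial.C c ^ 2 * Polynomial.X ^ 3
      + (8 * Polynomial.X - 2) * Polynomial.C c * Polynomial.X)) (by linear_combination h)
    simp at this

lemma cayley_irred (k : Type) [Field k] [CharZero k] : Irreducible (cayleyF k) := by
  let B := MvPolynomial (Fin 2) k
  let e := MvPolynomial.finSuccEquiv k 2
  have h432 : (-432 : k) ≠ 0 := by norm_num
  let c2 : B := C (-432 : k)⁻¹ * (X 1 ^ 3 - C 72 * X 0 * X 1)
  let c1 : B := C (-432 : k)⁻¹ * (C 8 * X 0 ^ 3 - C 2 * X 0 ^ 2 * X 1 ^ 2)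
  let c0 : B := C (-432 : k)⁻¹ * (X 0 ^ 4 * X 1)
  have hCC : (C (-432 : k) : B) * C (-432 : k)⁻¹ = 1 := by
    rw [← C_mul, mul_inv_cancel₀ h432, C_1]
  let P : Polynomial B := Polynomial.X ^ 3 + Polynomial.C c2 * Polynomial.X ^ 2
    + Polynomial.C c1 * Polynomial.X + Polynomial.C c0
  have heP : e (cayleyF k) = Polynomial.C (C (-432 : k)) * P := by
    have e0 : e (X 0) = Polynomial.X := MvPolynomial.finSuccEquiv_X_zero
    have e1 : e (X 1) = Polynomial.C (X 0) := MvPolynomial.finSuccEquiv_X_succ (j := 0)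
    have e2 : e (X 2) = Polynomial.C (X 1) := MvPolynomial.finSuccEquiv_X_succ (j := 1)
    have eC : ∀ a : k, e (C a) = Polynomial.C (C a) := fun a => by
      simp [e, MvPolynomial.finSuccEquiv_apply]
    have hCC' : (Polynomial.C (C (-432 : k) : B)) * Polynomial.C (C (-432 : k)⁻¹) = 1 := by
      rw [← Polynomial.C_mul, hCC, Polynomial.C_1]
    have hn : (Polynomial.C (C (-432 : k) : B)) = - Polynomial.C (C (432 : k) : B) := by
      simp
    simp only [cayleyF, map_add, map_sub, map_mul, map_pow, e0, e1, e2, eC, P, c2, c1, c0]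
    generalize (Polynomial.C (C (-432 : k)⁻¹ : B)) = i at *
    generalize (Polynomial.C (C (-432 : k) : B)) = i' at *
    have : Polynomial.C (C (432 : k) : B) = -i' := by rw [hn, neg_neg]
    rw [this]
    linear_combination (-Polynomial.X ^ 2 * (Polynomial.C (X 1) ^ 3 - Polynomial.C (C 72) * Polynomial.C (X 0) * Polynomial.C (X 1)) - Polynomial.X * (Polynomial.C (C 8) * Polynomial.C (X 0) ^ 3 - Polynomial.C (C 2) * Polynomial.C (X 0) ^ 2 * Polynomial.C (X 1) ^ 2) - (Polynomial.C (X 0) ^ 4 * Polynomial.C (X 1))) * hCC'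
  have hPd : P.natDegree = 3 := by
    simp only [P]; compute_degree!
  have hPm : P.Monic := by
    simp only [P]; monicity!
  have hP : Irreducible P := by
    rw [hPm.irreducible_iff_roots_eq_zero_of_degree_le_three (by omega) (by omega)]
    refine Multiset.eq_zero_of_forall_notMem fun r hr => ?_
    have hr0 := (Polynomial.mem_roots'.1 hr).2
    simp only [Polynomial.IsRoot, P, Polynomial.eval_add, Polynomial.eval_mul, Polynomial.eval_pow,
      Polynomial.eval_X, Polynomial.eval_C] at hr0
    let φ : B →ₐ[k] Polynomial k := aeval ![Polynomial.X, 1]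
    have hr1 := congrArg (fun t => φ (C (-432 : k) * t)) hr0
    refine cubic_no_root k (φ r) ?_
    have p0 : φ (X 0) = Polynomial.X := aeval_X _ _
    have p1 : φ (X 1) = 1 := aeval_X _ _
    have pC : ∀ a : k, φ (C a) = Polynomial.C a := fun a => aeval_C _ a
    have hCC' := congrArg φ hCC
    simp only [map_add, map_sub, map_mul, map_pow, p0, p1, pC, c2, c1, c0, map_zero, map_one] at hr1 hCC'
    generalize (Polynomial.C ((-432 : k)⁻¹)) = i at *
    simp only [map_neg, map_ofNat] at hr1 hCC'
    linear_combination hr1 - (φ r ^ 2 * (1 - 72 * Polynomial.X) + φ r * (8 * Polynomial.X ^ 3 - 2 * Polynomial.X ^ 2) + Polynomial.X ^ 4) * hCC'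
  have hu : IsUnit (Polynomial.C (C (-432 : k) : B)) :=
    Polynomial.isUnit_C.2 ((isUnit_iff_ne_zero.2 h432).map C)
  rw [← MulEquiv.irreducible_iff e.toMulEquiv]
  change Irreducible (e (cayleyF k))
  rw [heP]
  exact (irreducible_isUnit_mul hu).2 hP


lemma not_reg_of_map {k S : Type*} [Field k] [CommRing S]
    (hdim : ringKrullDim S ≤ 1)
    (ψ : S →+* TrivSqZeroExt k (k × k))
    (hs : ∀ c : k, ∃ a, (ψ a).fst = c) (a b : S)
    (ha : ψ a = TrivSqZeroExt.inr (1, 0)) (hb : ψ b = TrivSqZeroExt.inr (0, 1)) :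
    ¬ IsRegLocalRing S := by
  rintro ⟨-, hloc, s, hspan, hcard⟩
  rw [IsLocalRing.jacobson_eq_maximalIdeal ⊥ bot_ne_top] at hspan
  have hc1 : s.card ≤ 1 := by
    rw [← hcard] at hdim
    have h : ((s.card : ℕ∞) : WithBot ℕ∞) ≤ ((1 : ℕ∞) : WithBot ℕ∞) := hdim
    exact_mod_cast WithBot.coe_le_coe.1 h
  let χ : S →+* k := (TrivSqZeroExt.fstHom k k (k × k)).toRingHom.comp ψ
  have hχ : ∀ x, χ x = (ψ x).fst := fun _ => rfl
  have hker : RingHom.ker χ = IsLocalRing.maximalIdeal S :=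
    IsLocalRing.eq_maximalIdeal (RingHom.ker_isMaximal_of_surjective χ hs)
  have ham : a ∈ IsLocalRing.maximalIdeal S := by
    rw [← hker, RingHom.mem_ker, hχ, ha]; simp
  have hbm : b ∈ IsLocalRing.maximalIdeal S := by
    rw [← hker, RingHom.mem_ker, hχ, hb]; simp
  obtain ⟨g', hg', hgm⟩ : ∃ g' : S, IsLocalRing.maximalIdeal S ≤ Ideal.span {g'} ∧ χ g' = 0 := by
    rcases s.eq_empty_or_nonempty with h | ⟨g, hgs⟩
    · refine ⟨0, ?_, map_zero _⟩
      rw [← hspan, h]; simp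
    · refine ⟨g, ?_, ?_⟩
      · rw [← hspan]
        refine Ideal.span_mono fun x hx => ?_
        exact Finset.card_le_one.1 hc1 x hx g hgs
      · rw [← RingHom.mem_ker, hker, ← hspan]
        exact Ideal.subset_span hgs
  obtain ⟨a', ha'⟩ := Ideal.mem_span_singleton.1 (hg' ham)
  obtain ⟨b', hb'⟩ := Ideal.mem_span_singleton.1 (hg' hbm)
  rw [hχ] at hgm
  have h1 := congrArg ψ ha'
  have h2 := congrArg ψ hb'
  rw [ha, map_mul] at h1
  rw [hb, map_mul] at h2
  have h1' := congrArg TrivSqZeroExt.snd h1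
  have h2' := congrArg TrivSqZeroExt.snd h2
  simp [hgm, Prod.ext_iff] at h1' h2'
  grind

/-- The induced grading on the quotient. -/
def gradB (k : Type) [Field k] (f : MvPolynomial (Fin 3) k) (i : ℕ) :
    Submodule k (MvPolynomial (Fin 3) k ⧸ Ideal.span {f}) :=
  (weightedHomogeneousSubmodule k w3 i).map (Ideal.Quotient.mkₐ k (Ideal.span {f})).toLinearMap

instance gradB_monoid (k : Type) [Field k] (f : MvPolynomial (Fin 3) k) :
    SetLike.GradedMonoid (gradB k f) where
  one_mem := ⟨1, isWeightedHomogeneous_one k w3,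
    map_one (Ideal.Quotient.mkₐ k (Ideal.span {f}))⟩
  mul_mem := by
    rintro i j _ _ ⟨a, ha, rfl⟩ ⟨b, hb, rfl⟩
    exact ⟨a * b, IsWeightedHomogeneous.mul ha hb, map_mul (Ideal.Quotient.mkₐ k (Ideal.span {f})) a b⟩

lemma gradB_mem (k : Type) [Field k] (f : MvPolynomial (Fin 3) k) {i : ℕ}
    {r : MvPolynomial (Fin 3) k} (hr : r.IsWeightedHomogeneous w3 i) :
    Ideal.Quotient.mk (Ideal.span {f}) r ∈ gradB k f i := ⟨r, hr, rfl⟩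

attribute [local instance] weightedGradedAlgebra

/-- One graded piece of the quotient map. -/
def gradBpiece (k : Type) [Field k] (f : MvPolynomial (Fin 3) k) (i : ℕ) :
    weightedHomogeneousSubmodule k w3 i →ₗ[k] gradB k f i :=
  ((Ideal.Quotient.mkₐ k (Ideal.span {f})).toLinearMap.comp
    (weightedHomogeneousSubmodule k w3 i).subtype).codRestrict _
    (fun r => gradB_mem k f r.2)

/-- The decomposition map before passing to the quotient. -/
def gradBdec0 (k : Type) [Field k] (f : MvPolynomial (Fin 3) k) :
    MvPolynomial (Fin 3) k →ₐ[k] DirectSum ℕ (fun i => gradB k f i) :=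
  (DirectSum.toAlgebra k (fun i => weightedHomogeneousSubmodule k w3 i)
    (fun i => (DirectSum.lof k ℕ (fun i => gradB k f i) i).comp (gradBpiece k f i))
    (by
      rw [DirectSum.one_def]
      refine DirectSum.of_eq_of_gradedMonoid_eq ?_
      refine Sigma.subtype_ext rfl ?_
      exact map_one (Ideal.Quotient.mkₐ k (Ideal.span {f})))
    (by
      intro i j a b
      refine Eq.trans ?_ (DirectSum.of_mul_of _ _).symm
      refine DirectSum.of_eq_of_gradedMonoid_eq ?_
      refine Sigma.subtype_ext rfl ?_
      exact map_mul (Ideal.Quotient.mkₐ k (Ideal.span {f})) _ _)).comp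
  (DirectSum.decomposeAlgEquiv (weightedHomogeneousSubmodule k w3)).toAlgHom

lemma gradBdec0_hom (k : Type) [Field k] (f : MvPolynomial (Fin 3) k) {i : ℕ}
    {r : MvPolynomial (Fin 3) k} (hr : r.IsWeightedHomogeneous w3 i) :
    gradBdec0 k f r = DirectSum.of (fun i => gradB k f i) i
      ⟨Ideal.Quotient.mk _ r, gradB_mem k f hr⟩ := by
  have h : DirectSum.decompose (weightedHomogeneousSubmodule k w3) r
    = DirectSum.of (fun i => weightedHomogeneousSubmodule k w3 i) i ⟨r, hr⟩ :=
    DirectSum.decompose_of_mem _ hr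
  simp only [gradBdec0, AlgHom.comp_apply]
  erw [DirectSum.decomposeAlgEquiv_apply, h]
  refine (DirectSum.toAddMonoid_of _ i _).trans ?_
  rfl

/-- The decomposition map. -/
def gradBdec (k : Type) [Field k] (f : MvPolynomial (Fin 3) k) {n : ℕ}
    (hf : f.IsWeightedHomogeneous w3 n) :
    (MvPolynomial (Fin 3) k ⧸ Ideal.span {f}) →ₐ[k] DirectSum ℕ (fun i => gradB k f i) :=
  Ideal.Quotient.liftₐ _ (gradBdec0 k f) (by
    intro a ha
    obtain ⟨b, rfl⟩ := Ideal.mem_span_singleton.1 ha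
    have : gradBdec0 k f f = 0 := by
      rw [gradBdec0_hom k f hf]
      have h0 : (⟨Ideal.Quotient.mk _ f, gradB_mem k f hf⟩ : gradB k f n) = 0 :=
        Subtype.ext (Ideal.Quotient.eq_zero_iff_mem.2 (Ideal.mem_span_singleton_self f))
      rw [h0, map_zero]
    rw [map_mul, this, zero_mul])

lemma gradBdec_mk (k : Type) [Field k] (f : MvPolynomial (Fin 3) k) {n : ℕ}
    (hf : f.IsWeightedHomogeneous w3 n) (r : MvPolynomial (Fin 3) k) :
    gradBdec k f hf (Ideal.Quotient.mk _ r) = gradBdec0 k f r := rfl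

/-- The graded algebra structure on the quotient. -/
@[reducible] def gradBAlg (k : Type) [Field k] (f : MvPolynomial (Fin 3) k) {n : ℕ}
    (hf : f.IsWeightedHomogeneous w3 n) : GradedAlgebra (gradB k f) :=
  GradedAlgebra.ofAlgHom _ (gradBdec k f hf)
    (by
      refine Ideal.Quotient.algHom_ext k (MvPolynomial.algHom_ext fun i => ?_)
      simp only [AlgHom.comp_apply, Ideal.Quotient.mkₐ_eq_mk]
      rw [gradBdec_mk, gradBdec0_hom k f (isWeightedHomogeneous_X k w3 i), DirectSum.coeAlgHom_of]
      rfl)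
    (by
      rintro i ⟨_, r, hr, rfl⟩
      exact gradBdec0_hom k f hr)


open AlgebraicGeometry HomogeneousLocalization in
lemma stalk_not_reg (k : Type) [Field k] {A : Type} [CommRing A] [Algebra k A]
    (ℬ : ℕ → Submodule k A) [GradedAlgebra ℬ] (z : A) (hz : z ∈ ℬ 1)
    (hdim : ringKrullDim (Away ℬ z) ≤ 1)
    (ψ : Away ℬ z →+* TrivSqZeroExt k (k × k))
    (hs : ∀ c : k, ∃ a, (ψ a).fst = c) (a b : Away ℬ z)
    (ha : ψ a = TrivSqZeroExt.inr (1, 0)) (hb : ψ b = TrivSqZeroExt.inr (0, 1))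
    (q : PrimeSpectrum (Away ℬ z)) (hq : ∀ x, (ψ x).fst = 0 → x ∈ q.asIdeal) :
    ¬ IsRegLocalRing ((Proj ℬ).presheaf.stalk (Proj.awayι ℬ z hz Nat.one_pos q)) := by
  let S := (Spec (CommRingCat.of (Away ℬ z))).presheaf.stalk q
  have hiso : ∀ p : Spec (CommRingCat.of (Away ℬ z)),
      CategoryTheory.IsIso ((Proj.awayι ℬ z hz Nat.one_pos).stalkMap p) := fun p => inferInstance
  have := hiso q
  let e : (Proj ℬ).presheaf.stalk (Proj.awayι ℬ z hz Nat.one_pos q) ≃+* S :=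
    (CategoryTheory.asIso ((Proj.awayι ℬ z hz Nat.one_pos).stalkMap
      (q : Spec (CommRingCat.of (Away ℬ z))))).commRingCatIsoToRingEquiv
  let _ : Algebra (Away ℬ z) S := StructureSheaf.stalkAlgebra (Away ℬ z) q
  have : IsLocalization.AtPrime S q.asIdeal := StructureSheaf.IsLocalization.to_stalk (Away ℬ z) q
  have hunit : ∀ y : q.asIdeal.primeCompl, IsUnit (ψ y) := by
    intro y
    rw [TrivSqZeroExt.isUnit_iff_isUnit_fst, isUnit_iff_ne_zero]
    exact fun h => y.2 (hq _ h)
  let Ψ : S →+* TrivSqZeroExt k (k × k) := IsLocalization.lift (M := q.asIdeal.primeCompl) hunit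
  have hΨ : ∀ x, Ψ (algebraMap _ S x) = ψ x := fun x => IsLocalization.lift_eq hunit x
  refine not_reg_of_map (k := k) ?_ (Ψ.comp e.toRingHom) ?_ (e.symm (algebraMap _ S a))
    (e.symm (algebraMap _ S b)) ?_ ?_
  · rw [ringKrullDim_eq_of_ringEquiv e, IsLocalization.AtPrime.ringKrullDim_eq_height q.asIdeal S]
    exact Ideal.height_le_ringKrullDim_of_isPrime.trans hdim
  · intro c
    obtain ⟨x, hx⟩ := hs c
    exact ⟨e.symm (algebraMap _ S x), by simp [hΨ, hx]⟩
  · simp [hΨ, ha]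
  · simp [hΨ, hb]


lemma cayley_hom (k : Type) [Field k] : (cayleyF k).IsWeightedHomogeneous w3 9 := by
  have h0 : (X 0 : MvPolynomial (Fin 3) k).IsWeightedHomogeneous w3 3 := isWeightedHomogeneous_X k w3 0
  have h1 : (X 1 : MvPolynomial (Fin 3) k).IsWeightedHomogeneous w3 2 := isWeightedHomogeneous_X k w3 1
  have h2 : (X 2 : MvPolynomial (Fin 3) k).IsWeightedHomogeneous w3 1 := isWeightedHomogeneous_X k w3 2
  have hC : ∀ a : k, (C a : MvPolynomial (Fin 3) k).IsWeightedHomogeneous w3 0 :=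
    fun a => isWeightedHomogeneous_C w3 a
  have hs : ∀ {p q : MvPolynomial (Fin 3) k}, p.IsWeightedHomogeneous w3 9 →
    q.IsWeightedHomogeneous w3 9 → (p - q).IsWeightedHomogeneous w3 9 := fun {p q} hp hq =>
    (weightedHomogeneousSubmodule k w3 9).sub_mem hp hq
  have t1 := (h0.pow 2).mul (h2.pow 3)
  have t2 := (((hC 2).mul h0).mul (h1.pow 2)).mul (h2.pow 2)
  have t3 := (h1.pow 4).mul h2
  have t4 := (((hC 72).mul (h0.pow 2)).mul h1).mul h2
  have t5 := ((hC 8).mul h0).mul (h1.pow 3)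
  have t6 := (hC 432).mul (h0.pow 3)
  exact hs ((hs ((hs t1 t2).add t3) t4).add t5) t6

open HomogeneousLocalization in
lemma away_dim (k : Type) [Field k] [CharZero k] [GradedAlgebra (gradB k (cayleyF k))] :
    ringKrullDim (Away (gradB k (cayleyF k)) (Ideal.Quotient.mk (Ideal.span {cayleyF k}) (X 2))) ≤ 1 := by
  have hz : (Ideal.Quotient.mk (Ideal.span {cayleyF k})) (X 2) ∈ (gradB k (cayleyF k)) 1 := gradB_mem k _ (isWeightedHomogeneous_X k w3 2)
  let xx : Away (gradB k (cayleyF k)) ((Ideal.Quotient.mk (Ideal.span {cayleyF k})) (X 2)) := Away.mk (gradB k (cayleyF k)) hz 3 ((Ideal.Quotient.mk (Ideal.span {cayleyF k})) (X 0)) (gradB_mem k _ (isWeightedHomogeneous_X k w3 0))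
  let yy : Away (gradB k (cayleyF k)) ((Ideal.Quotient.mk (Ideal.span {cayleyF k})) (X 2)) := Away.mk (gradB k (cayleyF k)) hz 2 ((Ideal.Quotient.mk (Ideal.span {cayleyF k})) (X 1)) (gradB_mem k _ (isWeightedHomogeneous_X k w3 1))
  let h2 : MvPolynomial (Fin 2) k →+* Away (gradB k (cayleyF k)) ((Ideal.Quotient.mk (Ideal.span {cayleyF k})) (X 2)) :=
    eval₂Hom ((fromZeroRingHom (gradB k (cayleyF k)) _).comp (algebraMap k ((gradB k (cayleyF k)) 0))) ![xx, yy]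
  let dehom : MvPolynomial (Fin 3) k →+* MvPolynomial (Fin 2) k := eval₂Hom C ![X 0, X 1, 1]
  let L := Localization.Away ((Ideal.Quotient.mk (Ideal.span {cayleyF k})) (X 2))
  let val' : Away (gradB k (cayleyF k)) ((Ideal.Quotient.mk (Ideal.span {cayleyF k})) (X 2)) →+* L := algebraMap _ _
  have hval : ∀ x, val' x = x.val := fun _ => rfl
  let Φ2 : MvPolynomial (Fin 3) k →+* L := (val'.comp h2).comp dehom
  let Φ1 : MvPolynomial (Fin 3) k →+* L := (algebraMap _ L).comp (Ideal.Quotient.mk (Ideal.span {cayleyF k}))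
  have hmk : ∀ (n : ℕ) (a) (ha : a ∈ (gradB k (cayleyF k)) (n • 1)), val' (Away.mk (gradB k (cayleyF k)) hz n a ha) * (Φ1 (X 2)) ^ n = algebraMap _ L a := by
    intro n a ha
    rw [hval, Away.val_mk, Localization.mk_eq_mk']
    simp only [Φ1, RingHom.comp_apply, ← map_pow]
    exact IsLocalization.mk'_spec L _ _
  have hC : ∀ c, Φ1 (C c) = Φ2 (C c) := by
    intro c
    simp only [Φ1, Φ2, RingHom.comp_apply, dehom, h2, eval₂Hom_C]
    rfl
  have hx : Φ1 (X 0) = Φ2 (X 0) * Φ1 (X 2) ^ 3 := by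
    have : Φ2 (X 0) = val' xx := by simp [Φ2, dehom, h2]
    rw [this, hmk]; rfl
  have hy : Φ1 (X 1) = Φ2 (X 1) * Φ1 (X 2) ^ 2 := by
    have : Φ2 (X 1) = val' yy := by simp [Φ2, dehom, h2]
    rw [this, hmk]; rfl
  have hzz : Φ2 (X 2) = 1 := by simp [Φ2, dehom]
  have hmon : ∀ (d : Fin 3 →₀ ℕ) (c : k), Φ1 (monomial d c)
      = Φ2 (monomial d c) * Φ1 (X 2) ^ (Finsupp.weight w3 d) := by
    intro d c
    have hw : Finsupp.weight w3 d = d 0 * 3 + d 1 * 2 + d 2 := by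
      rw [Finsupp.weight_apply, Finsupp.sum_fintype _ _ (by simp), Fin.sum_univ_three]
      simp [w3]
    rw [hw, monomial_eq, Finsupp.prod_fintype _ _ (by simp), Fin.prod_univ_three]
    simp only [map_mul, map_pow, hC, hx, hy, hzz]
    ring
  have hhom : ∀ (n : ℕ) (r : MvPolynomial (Fin 3) k), r.IsWeightedHomogeneous w3 n →
      Φ1 r = Φ2 r * Φ1 (X 2) ^ n := by
    intro n r hr
    conv_lhs => rw [r.as_sum]
    conv_rhs => rw [r.as_sum]
    rw [map_sum, map_sum, Finset.sum_mul]
    refine Finset.sum_congr rfl fun d hd => ?_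
    rw [hmon, hr (mem_support_iff.1 hd)]
  have hzu : ∀ n, IsUnit (Φ1 (X 2) ^ n) := fun n =>
    (IsLocalization.Away.algebraMap_isUnit ((Ideal.Quotient.mk (Ideal.span {cayleyF k})) (X 2))).pow n
  have hsurj : Function.Surjective h2 := by
    intro x
    obtain ⟨n, a, ha, rfl⟩ := Away.mk_surjective (gradB k (cayleyF k)) hz x
    obtain ⟨r, hr, hra⟩ := id ha
    refine ⟨dehom r, val_injective _ ?_⟩
    rw [← hval, ← hval]
    refine (hzu n).mul_right_cancel ?_
    rw [hmk, ← hra]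
    have := hhom _ r hr
    simp only [smul_eq_mul, mul_one] at this
    exact this.symm
  have hF0 : h2 (dehom (cayleyF k)) = 0 := by
    refine val_injective _ ?_
    rw [← hval, ← hval, map_zero]
    refine (hzu 9).mul_right_cancel ?_
    rw [zero_mul]
    refine (hhom 9 _ (cayley_hom k)).symm.trans ?_
    have : (Ideal.Quotient.mk (Ideal.span {cayleyF k})) (cayleyF k) = 0 := Ideal.Quotient.eq_zero_iff_mem.2 (Ideal.mem_span_singleton_self _)
    simp only [Φ1, RingHom.comp_apply, this, map_zero]
  have hFne : dehom (cayleyF k) ≠ 0 := by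
    intro h
    have := congrArg (eval ![0, 1]) h
    simp [dehom, cayleyF] at this
  have := ringKrullDim_succ_le_of_surjective h2 hsurj (mem_nonZeroDivisors_of_ne_zero hFne) hF0
  rw [MvPolynomial.ringKrullDim_of_isNoetherianRing, ringKrullDim_eq_zero_of_field] at this
  simp only [Nat.card_eq_fintype_card, Fintype.card_fin, zero_add, Nat.cast_ofNat] at this
  revert this
  generalize ringKrullDim (Away (gradB k (cayleyF k)) (Ideal.Quotient.mk (Ideal.span {cayleyF k}) (X 2))) = d
  intro this
  induction d with
  | bot => exact bot_le
  | coe d =>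
    have h2 : d + 1 ≤ 1 + 1 := by
      have h3 : ((d + 1 : ℕ∞) : WithBot ℕ∞) ≤ ((1 + 1 : ℕ∞) : WithBot ℕ∞) := by
        refine le_trans (le_of_eq ?_) (this.trans (le_of_eq ?_))
        · rfl
        · rw [one_add_one_eq_two]; rfl
      exact WithBot.coe_le_coe.1 h3
    have h4 : d ≤ 1 := (ENat.add_le_add_iff_right ENat.one_ne_top).1 h2
    exact_mod_cast h4


open HomogeneousLocalization AlgebraicGeometry in
lemma sing_point (k : Type) [Field k] [CharZero k] [GradedAlgebra (gradB k (cayleyF k))]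
    (x0 y0 : k)
    (hF : aeval ![TrivSqZeroExt.inl x0 + TrivSqZeroExt.inr (1, 0),
      TrivSqZeroExt.inl y0 + TrivSqZeroExt.inr (0, 1), 1] (cayleyF k)
        = (0 : TrivSqZeroExt k (k × k)))
    (hz : Ideal.Quotient.mk (Ideal.span {cayleyF k}) (X 2) ∈ gradB k (cayleyF k) 1)
    (hy : Ideal.Quotient.mk (Ideal.span {cayleyF k}) (X 1) ∈ gradB k (cayleyF k) (2 • 1)) :
    ∃ (q : PrimeSpectrum (Away (gradB k (cayleyF k)) (Ideal.Quotient.mk (Ideal.span {cayleyF k}) (X 2))))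
      (χ : Away (gradB k (cayleyF k)) (Ideal.Quotient.mk (Ideal.span {cayleyF k}) (X 2)) →+* k),
      q.asIdeal = RingHom.ker χ ∧
      χ (Away.mk (gradB k (cayleyF k)) hz 2 _ hy) = y0 ∧
      ¬ IsRegLocalRing ((Proj (gradB k (cayleyF k))).presheaf.stalk
        (Proj.awayι (gradB k (cayleyF k)) _ hz Nat.one_pos q)) := by
  let T := TrivSqZeroExt k (k × k)
  let ρ : MvPolynomial (Fin 3) k →ₐ[k] T := aeval ![TrivSqZeroExt.inl x0 + TrivSqZeroExt.inr (1, 0),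
      TrivSqZeroExt.inl y0 + TrivSqZeroExt.inr (0, 1), 1]
  let ρ' : (MvPolynomial (Fin 3) k ⧸ Ideal.span {cayleyF k}) →+* T :=
    Ideal.Quotient.lift _ ρ.toRingHom (by
      intro a ha
      obtain ⟨b, rfl⟩ := Ideal.mem_span_singleton.1 ha
      change ρ (_ * _) = 0
      rw [map_mul]
      have : ρ (cayleyF k) = 0 := hF
      rw [this, zero_mul])
  have hρ : ∀ r, ρ' ((Ideal.Quotient.mk (Ideal.span {cayleyF k})) r) = ρ r := fun r => rfl
  have ρ2 : ρ (X 2) = 1 := aeval_X _ _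
  have ρ1 : ρ (X 1) = TrivSqZeroExt.inl y0 + TrivSqZeroExt.inr (0, 1) := aeval_X _ _
  have ρ0 : ρ (X 0) = TrivSqZeroExt.inl x0 + TrivSqZeroExt.inr (1, 0) := aeval_X _ _
  have ρC : ∀ c : k, ρ (C c) = TrivSqZeroExt.inl c := fun c => aeval_C _ c
  have hu : IsUnit (ρ' ((Ideal.Quotient.mk (Ideal.span {cayleyF k})) (X 2))) := by rw [hρ, ρ2]; exact isUnit_one
  let L := Localization.Away ((Ideal.Quotient.mk (Ideal.span {cayleyF k})) (X 2))
  let ψL : L →+* T := IsLocalization.Away.lift ((Ideal.Quotient.mk (Ideal.span {cayleyF k})) (X 2)) hu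
  have hψL : ∀ a, ψL (algebraMap _ L a) = ρ' a := fun a => IsLocalization.Away.lift_eq _ hu a
  let ψ : Away (gradB k (cayleyF k)) ((Ideal.Quotient.mk (Ideal.span {cayleyF k})) (X 2)) →+* T := ψL.comp (algebraMap _ L)
  have hψ : ∀ (n : ℕ) (r) (ha : (Ideal.Quotient.mk (Ideal.span {cayleyF k})) r ∈ (gradB k (cayleyF k)) (n • 1)), ψ (Away.mk (gradB k (cayleyF k)) hz n ((Ideal.Quotient.mk (Ideal.span {cayleyF k})) r) ha) = ρ r := by
    intro n r ha
    have h1 : (Away.mk (gradB k (cayleyF k)) hz n ((Ideal.Quotient.mk (Ideal.span {cayleyF k})) r) ha).val * (algebraMap _ L ((Ideal.Quotient.mk (Ideal.span {cayleyF k})) (X 2) ^ n)) = algebraMap _ L ((Ideal.Quotient.mk (Ideal.span {cayleyF k})) r) := by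
      rw [Away.val_mk, Localization.mk_eq_mk']
      exact IsLocalization.mk'_spec L _ _
    have h2 := congrArg ψL h1
    rw [map_mul, hψL, hψL, map_pow, hρ, hρ, ρ2, one_pow, mul_one] at h2
    exact h2
  let χ : Away (gradB k (cayleyF k)) ((Ideal.Quotient.mk (Ideal.span {cayleyF k})) (X 2)) →+* k := (TrivSqZeroExt.fstHom k k (k × k)).toRingHom.comp ψ
  have hχ : ∀ x, χ x = (ψ x).fst := fun _ => rfl
  have hX : ∀ i, (X i : MvPolynomial (Fin 3) k).IsWeightedHomogeneous w3 (w3 i) :=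
    fun i => isWeightedHomogeneous_X k w3 i
  have hm0 : (Ideal.Quotient.mk (Ideal.span {cayleyF k})) (X 0 - C x0 * X 2 ^ 3) ∈ (gradB k (cayleyF k)) (3 • 1) := gradB_mem k _
    ((weightedHomogeneousSubmodule k w3 3).sub_mem (hX 0)
      ((isWeightedHomogeneous_C w3 x0).mul ((hX 2).pow 3)))
  have hm1 : (Ideal.Quotient.mk (Ideal.span {cayleyF k})) (X 1 - C y0 * X 2 ^ 2) ∈ (gradB k (cayleyF k)) (2 • 1) := gradB_mem k _
    ((weightedHomogeneousSubmodule k w3 2).sub_mem (hX 1)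
      ((isWeightedHomogeneous_C w3 y0).mul ((hX 2).pow 2)))
  refine ⟨⟨RingHom.ker χ, RingHom.ker_isPrime χ⟩, χ, rfl, ?_, ?_⟩
  · rw [hχ, hψ, ρ1]; exact add_zero y0
  · refine stalk_not_reg k (gradB k (cayleyF k)) _ hz (away_dim k) ψ ?_ (Away.mk (gradB k (cayleyF k)) hz 3 _ hm0) (Away.mk (gradB k (cayleyF k)) hz 2 _ hm1)
      ?_ ?_ _ ?_
    · intro c
      refine ⟨Away.mk (gradB k (cayleyF k)) hz 0 ((Ideal.Quotient.mk (Ideal.span {cayleyF k})) (C c)) (gradB_mem k _ (isWeightedHomogeneous_C w3 c)), ?_⟩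
      rw [hψ, ρC]; simp
    · rw [hψ, map_sub, map_mul, map_pow, ρ0, ρ2, ρC]; simp
    · rw [hψ, map_sub, map_mul, map_pow, ρ1, ρ2, ρC]; simp
    · exact fun x hx => hx

lemma cayley_C2 (k : Type) [Field k] [CharZero k] : CondC2 k (cayleyF k) := by
  letI inst : GradedAlgebra (gradB k (cayleyF k)) := gradBAlg k _ (cayley_hom k)
  refine ⟨gradB k (cayleyF k), inst, fun i r hr => gradB_mem k _ hr, ?_⟩
  have hz : Ideal.Quotient.mk (Ideal.span {cayleyF k}) (X 2) ∈ gradB k (cayleyF k) 1 :=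
    gradB_mem k _ (isWeightedHomogeneous_X k w3 2)
  have hy : Ideal.Quotient.mk (Ideal.span {cayleyF k}) (X 1) ∈ gradB k (cayleyF k) (2 • 1) :=
    gradB_mem k _ (isWeightedHomogeneous_X k w3 1)
  obtain ⟨q1, χ1, hq1, h1, hs1⟩ := sing_point k 0 0 (by
    simp only [cayleyF, map_add, map_sub, map_mul, map_pow, aeval_X, aeval_C]
    ext <;> simp [pow_succ, TrivSqZeroExt.algebraMap_eq_inl]) hz hy
  obtain ⟨q2, χ2, hq2, h2, hs2⟩ := sing_point k (-1/27) (1/3) (by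
    simp only [cayleyF, map_add, map_sub, map_mul, map_pow, aeval_X, aeval_C]
    ext <;> simp [pow_succ, TrivSqZeroExt.algebraMap_eq_inl] <;> norm_num) hz hy
  refine ⟨_, _, ?_, hs1, hs2⟩
  intro h
  have hq : q1 = q2 := (AlgebraicGeometry.Proj.awayι _ _ hz Nat.one_pos).isOpenEmbedding.injective h
  have hmem : HomogeneousLocalization.Away.mk (gradB k (cayleyF k)) hz 2 _ hy ∈ q2.asIdeal := by
    rw [← hq, hq1]; exact h1
  rw [hq2, RingHom.mem_ker, h2] at hmem
  norm_num at hmem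

/-- The polynomial `F = x²z³ - 2xy²z² + y⁴z - 72x²yz + 8xy³ - 432x³` is homogeneous of
degree 9 (for the weights `(3,2,1)`) and satisfies conditions (C1)-(C4): it is irreducible,
the curve `Proj (R/FR)` has at least two singular points, `F(x,y,0) = x(-432 x² + 8 y³)`
with `p = -432, q = 8 ∈ k*`, and `F_z(x,y,0) = y(-72 x² + y³)` with `r = -72, s = 1` and
`3ps - qr ≠ 0`. -/
theorem statement_19 (k : Type) [Field k] [IsAlgClosed k] [CharZero k] :
    (cayleyF k).IsWeightedHomogeneous w3 9 ∧
    Irreducible (cayleyF k) ∧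
    CondC2 k (cayleyF k) ∧
    (aeval ![X 0, X 1, 0] (cayleyF k)
      = X 0 * (C (-432 : k) * X 0 ^ 2 + C (8 : k) * X 1 ^ 3) ∧
      (-432 : k) ≠ 0 ∧ (8 : k) ≠ 0) ∧
    (aeval ![X 0, X 1, 0] (pderiv 2 (cayleyF k))
      = X 1 * (C (-72 : k) * X 0 ^ 2 + C (1 : k) * X 1 ^ 3) ∧
      3 * (-432 : k) * (1 : k) - (8 : k) * (-72 : k) ≠ 0) := by
  refine ⟨cayley_hom k, cayley_irred k, cayley_C2 k, ⟨?_, by norm_num, by norm_num⟩, ?_, by norm_num⟩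
  · simp [cayleyF]
    ring
  · simp [cayleyF, pderiv_X, Pi.single_apply]
    ring
end
end
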